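/- Fix r ≥ 2, ε > 0, a strictly increasing sequence 0 = x_0 < x_1 < ⋯ < x_{r−1} = 1, and a tuple (Q_1,…,Q_{r−1}) with positive definite increments. Suppose Λ = (Q − Q_{r−1})⁻¹ + ξ'(Q) − ξ'(Q_{r−1}) + ε E_{r−1} and D_p⁻¹ = Λ_p + ε Ē_p for every 1 ≤ p ≤ r−1. Then P_r^ε(Λ, Q̲) ≥ P_r(Λ̃, x̲, Q̲), where Λ̃ = Λ + ε Ē_1 (which satisfies det Λ̃_1 > 0, so the right-hand side is well defined), P_r is the discrete Parisi functional, and P_r^ε is the perturbed Parisi functional P_r^ε(Λ, Q̲) = (1/2)[⟨Λ, Q⟩ − n − log det Λ + Σ_{k=1}^{r−1} (1/x_k) log(det Λ_{k+1}(ε)/det Λ_k(ε)) + ⟨Λ_1(ε)⁻¹, h hᵀ + ξ'(Q_1)⟩ − Σ_{k=1}^{r−1} x_k · Sum(θ(Q_{k+1}) − θ(Q_k)) − ε Σ_{k=1}^{r−2} ⟨Ē_{k+1} − Ē_k, Q_k⟩ + Σ_{k=1}^{r−2} (ε/x_k) ⟨Λ_k(ε)⁻¹, Ē_k − Ē_{k+1}⟩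 + ε ⟨Λ_{r−1}(ε)⁻¹, Ē_{r−1}⟩ + ε ⟨Q_{r−1}, Ē_{r−1}⟩ − ε Σ_{k=0}^{r−1} log det(Q_{k+1} − Q_k)], with Λ_p(ε) = Λ_p + ε Ē_p. -/

import Mathlib

open Matrix BigOperators Filter MeasureTheory

noncomputable section

namespace SphericalSG

abbrev Mat (n : ℕ) := Matrix (Fin n) (Fin n) ℝ

variable {n : ℕ}

/-- Frobenius inner product `⟨A,B⟩ = tr(AB)`. -/
def ip (A B : Mat n) : ℝ := (A * B).trace

/-- Sum of all entries of a matrix. -/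
def matSum (A : Mat n) : ℝ := ∑ i, ∑ j, A i j

/-- `ξ(A) = Σ_{p≥2} (β_p β_pᵀ) ⊙ A^{∘p}` (entrywise). -/
def xiM (β : ℕ → Fin n → ℝ) (A : Mat n) : Mat n :=
  Matrix.of fun i j => ∑' p : ℕ, β (p + 2) i * β (p + 2) j * A i j ^ (p + 2)

/-- `ξ'(A) = Σ_{p≥2} p (β_p β_pᵀ) ⊙ A^{∘(p-1)}`. -/
def xi'M (β : ℕ → Fin n → ℝ) (A : Mat n) : Mat n :=
  Matrix.of fun i j => ∑' p : ℕ, ((p : ℝ) + 2) * (β (p + 2) i * β (p + 2) j * A i j ^ (p + 1))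

/-- `ξ''(A) = Σ_{p≥2} p(p-1) (β_p β_pᵀ) ⊙ A^{∘(p-2)}`. -/
def xi''M (β : ℕ → Fin n → ℝ) (A : Mat n) : Mat n :=
  Matrix.of fun i j =>
    ∑' p : ℕ, ((p : ℝ) + 2) * ((p : ℝ) + 1) * (β (p + 2) i * β (p + 2) j * A i j ^ p)

/-- `θ(A) = Σ_{p≥2} (p-1) (β_p β_pᵀ) ⊙ A^{∘p}`. -/
def thetaM (β : ℕ → Fin n → ℝ) (A : Mat n) : Mat n :=
  Matrix.of fun i j => ∑' p : ℕ, ((p : ℝ) + 1) * (β (p + 2) i * β (p + 2) j * A i j ^ (p + 2))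

/-- `Λ_p = Λ - Σ_{k=p}^{r-1} x_k (ξ'(Q_{k+1}) - ξ'(Q_k))`, with `Λ_r = Λ`. -/
def Lam (β : ℕ → Fin n → ℝ) (x : ℕ → ℝ) (Qs : ℕ → Mat n) (Λ : Mat n) (r p : ℕ) : Mat n :=
  Λ - ∑ k ∈ Finset.Ico p r, x k • (xi'M β (Qs (k + 1)) - xi'M β (Qs k))

/-- `D_p = Σ_{k=p}^{r-1} x_k (Q_{k+1} - Q_k)`. -/
def Dmat (x : ℕ → ℝ) (Qs : ℕ → Mat n) (r p : ℕ) : Mat n :=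
  ∑ k ∈ Finset.Ico p r, x k • (Qs (k + 1) - Qs k)

/-- The discrete Parisi functional `𝒫_r(Λ, x̲, Q̲)`. -/
def Pfun (β : ℕ → Fin n → ℝ) (h : Fin n → ℝ) (Q : Mat n) (r : ℕ)
    (Λ : Mat n) (x : ℕ → ℝ) (Qs : ℕ → Mat n) : ℝ :=
  (1 / 2) * (ip (vecMulVec h h) (Lam β x Qs Λ r 1)⁻¹ + ip Λ Q - (n : ℝ)
    - Real.log Λ.det
    + ∑ k ∈ Finset.Ico 1 r,
        (1 / x k) * Real.log ((Lam β x Qs Λ r (k + 1)).det / (Lam β x Qs Λ r k).det)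
    + ip (xi'M β (Qs 1)) (Lam β x Qs Λ r 1)⁻¹
    - ∑ k ∈ Finset.Ico 1 r, x k * matSum (thetaM β (Qs (k + 1)) - thetaM β (Qs k)))

/-- The discrete Crisanti–Sommers functional `𝒞_r(x̲, Q̲)`. -/
def Cfun (β : ℕ → Fin n → ℝ) (h : Fin n → ℝ) (Q : Mat n) (r : ℕ)
    (x : ℕ → ℝ) (Qs : ℕ → Mat n) : ℝ :=
  (1 / 2) * (ip (vecMulVec h h) (Dmat x Qs r 1)
    + (1 / x (r - 1)) * Real.log (Q - Qs (r - 1)).det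
    - ∑ k ∈ Finset.Ico 1 (r - 1),
        (1 / x k) * Real.log ((Dmat x Qs r (k + 1)).det / (Dmat x Qs r k).det)
    + ip (Qs 1) (Dmat x Qs r 1)⁻¹
    + ∑ k ∈ Finset.Ico 1 r, x k * matSum (xiM β (Qs (k + 1)) - xiM β (Qs k)))

/-- A discrete path `(x̲, Q̲)` of order `r`:
`0 = x_0 ≤ x_1 ≤ ⋯ ≤ x_{r-1} ≤ 1` and `0 = Q_0 ⪯ Q_1 ⪯ ⋯ ⪯ Q_r = Q`. -/
structure IsPath (Q : Mat n) (r : ℕ) (x : ℕ → ℝ) (Qs : ℕ → Mat n) : Prop where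
  x0 : x 0 = 0
  xmono : ∀ k, k + 1 ≤ r - 1 → x k ≤ x (k + 1)
  xtop : x (r - 1) ≤ 1
  Q0 : Qs 0 = 0
  Qr : Qs r = Q
  inc : ∀ k < r, (Qs (k + 1) - Qs k).PosSemidef

/-- A tuple `(Q_1, …, Q_{r-1})` with positive definite increments,
`Q_0 = 0` and `Q_r = Q`. -/
structure IsStrictTuple (Q : Mat n) (r : ℕ) (Qs : ℕ → Mat n) : Prop where
  Q0 : Qs 0 = 0
  Qr : Qs r = Q
  inc : ∀ k < r, (Qs (k + 1) - Qs k).PosDef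

/-- A strictly increasing sequence `0 = x_0 < x_1 < ⋯ < x_{r-1} = 1`. -/
structure IsStrictSeq (r : ℕ) (x : ℕ → ℝ) : Prop where
  x0 : x 0 = 0
  xmono : ∀ k, k + 1 ≤ r - 1 → x k < x (k + 1)
  xtop : x (r - 1) = 1

/-- `Ē_p = Σ_{k=p}^{r-1} x_k (E_{k+1} - E_k)`. -/
def Ebar (x : ℕ → ℝ) (E : ℕ → Mat n) (r p : ℕ) : Mat n :=
  ∑ k ∈ Finset.Ico p r, x k • (E (k + 1) - E k)

/-- The error matrices for the Parisi critical point, with entrywise division by `ξ''`: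
`E_p = (1/(x_p - x_{p-1})) ((Q_{p+1}-Q_p)⁻¹ - (Q_p-Q_{p-1})⁻¹) ⊘ ξ''(Q_p)`
for `1 ≤ p ≤ r-1`, and `E_p = 0` otherwise (in particular `E_r = 0`). -/
def EP (β : ℕ → Fin n → ℝ) (x : ℕ → ℝ) (Qs : ℕ → Mat n) (r p : ℕ) : Mat n :=
  if 1 ≤ p ∧ p ≤ r - 1 then
    Matrix.of fun i j =>
      (1 / (x p - x (p - 1))) *
        ((((Qs (p + 1) - Qs p)⁻¹ - (Qs p - Qs (p - 1))⁻¹) i j) / xi''M β (Qs p) i j)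
  else 0

/-- The error matrices for the Crisanti–Sommers critical point:
`E_p = (1/(x_p - x_{p-1})) ((Q_{p+1}-Q_p)⁻¹ - (Q_p-Q_{p-1})⁻¹)` for `1 ≤ p ≤ r-1`,
and `E_p = 0` otherwise (in particular `E_r = 0`). -/
def EC (x : ℕ → ℝ) (Qs : ℕ → Mat n) (r p : ℕ) : Mat n :=
  if 1 ≤ p ∧ p ≤ r - 1 then
    (1 / (x p - x (p - 1))) • ((Qs (p + 1) - Qs p)⁻¹ - (Qs p - Qs (p - 1))⁻¹)
  else 0

/-- The logarithmic barrier `Σ_{k=0}^{r-1} log det (Q_{k+1} - Q_k)`. -/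
def barrier (Qs : ℕ → Mat n) (r : ℕ) : ℝ :=
  ∑ k ∈ Finset.range r, Real.log ((Qs (k + 1) - Qs k).det)

/-- The barrier-perturbed Parisi functional `𝒫_r^ε`. -/
def PfunEps (β : ℕ → Fin n → ℝ) (h : Fin n → ℝ) (Q : Mat n) (r : ℕ) (ε : ℝ)
    (Λ : Mat n) (x : ℕ → ℝ) (Qs : ℕ → Mat n) : ℝ :=
  Pfun β h Q r Λ x Qs - (ε / 2) * barrier Qs r

/-- The barrier-perturbed Crisanti–Sommers functional `𝒞_r^ε`. -/
def CfunEps (β : ℕ → Fin n → ℝ) (h : Fin n → ℝ) (Q : Mat n) (r : ℕ) (ε : ℝ)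
    (x : ℕ → ℝ) (Qs : ℕ → Mat n) : ℝ :=
  Cfun β h Q r x Qs - (ε / 2) * barrier Qs r

/-- `D_p(ε) = D_p + ε Ē_p` (with the `EP` errors). -/
def DE (β : ℕ → Fin n → ℝ) (x : ℕ → ℝ) (Qs : ℕ → Mat n) (r : ℕ) (ε : ℝ) (p : ℕ) : Mat n :=
  Dmat x Qs r p + ε • Ebar x (EP β x Qs r) r p

/-- `Λ_p(ε) = Λ_p + ε Ē_p` (with the `EC` errors). -/
def LE (β : ℕ → Fin n → ℝ) (x : ℕ → ℝ) (Qs : ℕ → Mat n) (Λ : Mat n) (r : ℕ) (ε : ℝ)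
    (p : ℕ) : Mat n :=
  Lam β x Qs Λ r p + ε • Ebar x (EC x Qs r) r p

/-- The approximate Crisanti–Sommers functional `𝒞_r^ε(Q̲)` obtained from the
perturbed Parisi functional at its critical point. -/
def CfunEpsApprox (β : ℕ → Fin n → ℝ) (h : Fin n → ℝ) (r : ℕ) (ε : ℝ)
    (x : ℕ → ℝ) (Qs : ℕ → Mat n) : ℝ :=
  (1 / 2) * (ip (vecMulVec h h) (DE β x Qs r ε 1)
    + (1 / x (r - 1)) * Real.log (DE β x Qs r ε (r - 1)).det
    - ∑ k ∈ Finset.Ico 1 (r - 1),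
        (1 / x k) * Real.log ((DE β x Qs r ε (k + 1)).det / (DE β x Qs r ε k).det)
    + ip (Qs 1) (DE β x Qs r ε 1)⁻¹
    + ∑ k ∈ Finset.Ico 1 r, x k * matSum (xiM β (Qs (k + 1)) - xiM β (Qs k))
    - ε * ∑ k ∈ Finset.Ico 1 (r - 1),
        ip (Ebar x (EP β x Qs r) r (k + 1) - Ebar x (EP β x Qs r) r k) (xi'M β (Qs (k + 1)))
    - ∑ k ∈ Finset.Ico 1 (r - 1),
        (ε / x k) * ip (DE β x Qs r ε (k + 1))⁻¹
          (Ebar x (EP β x Qs r) r k - Ebar x (EP β x Qs r) r (k + 1))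
    - ε * ip (DE β x Qs r ε (r - 1))⁻¹ (Ebar x (EP β x Qs r) r (r - 1))
    + ε * ip (xi'M β (Qs (r - 1))) (Ebar x (EP β x Qs r) r (r - 1))
    - ε * barrier Qs r)

/-- The approximate Parisi functional `𝒫_r^ε(Λ, Q̲)` obtained from the
perturbed Crisanti–Sommers functional at its critical point. -/
def PfunEpsApprox (β : ℕ → Fin n → ℝ) (h : Fin n → ℝ) (Q : Mat n) (r : ℕ) (ε : ℝ)
    (Λ : Mat n) (x : ℕ → ℝ) (Qs : ℕ → Mat n) : ℝ :=
  (1 / 2) * (ip Λ Q - (n : ℝ) - Real.log Λ.det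
    + ∑ k ∈ Finset.Ico 1 r,
        (1 / x k) * Real.log ((LE β x Qs Λ r ε (k + 1)).det / (LE β x Qs Λ r ε k).det)
    + ip (LE β x Qs Λ r ε 1)⁻¹ (vecMulVec h h + xi'M β (Qs 1))
    - ∑ k ∈ Finset.Ico 1 r, x k * matSum (thetaM β (Qs (k + 1)) - thetaM β (Qs k))
    - ε * ∑ k ∈ Finset.Ico 1 (r - 1),
        ip (Ebar x (EC x Qs r) r (k + 1) - Ebar x (EC x Qs r) r k) (Qs k)
    + ∑ k ∈ Finset.Ico 1 (r - 1),
        (ε / x k) * ip (LE β x Qs Λ r ε k)⁻¹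
          (Ebar x (EC x Qs r) r k - Ebar x (EC x Qs r) r (k + 1))
    + ε * ip (LE β x Qs Λ r ε (r - 1))⁻¹ (Ebar x (EC x Qs r) r (r - 1))
    + ε * ip (Qs (r - 1)) (Ebar x (EC x Qs r) r (r - 1))
    - ε * barrier Qs r)

/-! Continuous-time objects -/

/-- The entrywise derivative `Φ'(t)`. -/
def phiD (Φ : ℝ → Mat n) (t : ℝ) : Mat n := Matrix.of fun i j => deriv (fun s => Φ s i j) t

/-- `Φ̂(t) = ∫_t^n x(s) Φ'(s) ds` (entrywise). -/
def phiHat (x : ℝ → ℝ) (Φ : ℝ → Mat n) (t : ℝ) : Mat n :=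
  Matrix.of fun i j => ∫ s in t..(n : ℝ), x s * phiD Φ s i j

/-- `t_x = inf { t ∈ [0, n] : x(t) ≥ 1 }`. -/
def txx (nR : ℝ) (x : ℝ → ℝ) : ℝ := sInf {t : ℝ | t ∈ Set.Icc 0 nR ∧ 1 ≤ x t}

/-- The Crisanti–Sommers functional `𝒞(x, Φ)` in integral form. -/
def Ccont (β : ℕ → Fin n → ℝ) (h : Fin n → ℝ) (Q : Mat n)
    (x : ℝ → ℝ) (Φ : ℝ → Mat n) : ℝ :=
  (1 / 2) * ((∫ t in (0:ℝ)..(n : ℝ), x t * ip (xi'M β (Φ t) + vecMulVec h h) (phiD Φ t))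
    + Real.log (Q - Φ (txx (n : ℝ) x)).det
    + ∫ t in (0:ℝ)..(txx (n : ℝ) x), ip (phiHat x Φ t)⁻¹ (phiD Φ t))

/-- An admissible monotone matrix path `Φ` parametrized by its trace. -/
structure AdmPath (Q : Mat n) (Φ : ℝ → Mat n) : Prop where
  zero : Φ 0 = 0
  top : Φ (n : ℝ) = Q
  tr : ∀ t ∈ Set.Icc (0:ℝ) (n : ℝ), (Φ t).trace = t
  psd : ∀ t ∈ Set.Icc (0:ℝ) (n : ℝ), (Φ t).PosSemidef
  mono : ∀ s t : ℝ, s ∈ Set.Icc (0:ℝ) (n : ℝ) → t ∈ Set.Icc (0:ℝ) (n : ℝ) → s ≤ t →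
    (Φ t - Φ s).PosSemidef
  lip : ∀ i j, LipschitzOnWith 1 (fun t => Φ t i j) (Set.Icc (0:ℝ) (n : ℝ))

/-- An admissible c.d.f.: right-continuous, nondecreasing, from `[0,n]` to `[0,1]`,
with `x(0) = 0` and `x(n) = 1`. -/
structure AdmCDF (n : ℕ) (x : ℝ → ℝ) : Prop where
  zero : x 0 = 0
  top : x (n : ℝ) = 1
  mono : MonotoneOn x (Set.Icc (0:ℝ) (n : ℝ))
  mem : ∀ t ∈ Set.Icc (0:ℝ) (n : ℝ), x t ∈ Set.Icc (0:ℝ) 1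
  rightCont : ∀ t ∈ Set.Ico (0:ℝ) (n : ℝ), ContinuousWithinAt x (Set.Ici t) t

/-- An admissible pair `(x, Φ)` with `det(Q - Φ(t_x)) > 0`. -/
def AdmPair (Q : Mat n) (x : ℝ → ℝ) (Φ : ℝ → Mat n) : Prop :=
  AdmCDF n x ∧ AdmPath Q Φ ∧ 0 < (Q - Φ (txx (n : ℝ) x)).det

/-- Membership in the set `A_{T,L}`. -/
def ATL (Q : Mat n) (T L : ℝ) (x : ℝ → ℝ) (Φ : ℝ → Mat n) : Prop :=
  AdmPair Q x Φ ∧ (∀ t : ℝ, T ≤ t → t ≤ (n : ℝ) → x t = 1) ∧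
    ∀ i j, |(Q - Φ (txx (n : ℝ) x))⁻¹ i j| ≤ L

end SphericalSG

namespace SphericalSG


section Helpers

variable {n : ℕ}

lemma ip_comm (A B : Mat n) : ip A B = ip B A := by
  unfold ip; exact Matrix.trace_mul_comm A B

lemma ip_add_left (A B C : Mat n) : ip (A + B) C = ip A C + ip B C := by
  simp [ip, add_mul]

lemma ip_sub_left (A B C : Mat n) : ip (A - B) C = ip A C - ip B C := by
  simp [ip, sub_mul]

lemma ip_smul_left (c : ℝ) (A B : Mat n) : ip (c • A) B = c * ip A B := by
  simp [ip]

lemma ip_add_right (A B C : Mat n) : ip A (B + C) = ip A B + ip A C := by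
  simp [ip, mul_add]

lemma ip_sub_right (A B C : Mat n) : ip A (B - C) = ip A B - ip A C := by
  simp [ip, mul_sub]

lemma ip_smul_right (c : ℝ) (A B : Mat n) : ip A (c • B) = c * ip A B := by
  simp [ip]

lemma ip_zero_left (A : Mat n) : ip 0 A = 0 := by simp [ip]

lemma ip_zero_right (A : Mat n) : ip A 0 = 0 := by simp [ip]

/-- `log det M ≤ tr M - n`. -/
lemma log_det_le_trace (M : Mat n) (hM : M.PosDef) :
    Real.log M.det ≤ M.trace - n := by
  have hd := hM.isHermitian.det_eq_prod_eigenvalues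
  have ht := hM.isHermitian.trace_eq_sum_eigenvalues
  simp only [RCLike.ofReal_real_eq_id, id] at hd ht
  rw [hd, ht, Real.log_prod (fun i _ => (hM.eigenvalues_pos i).ne')]
  have : ∑ i, Real.log (hM.isHermitian.eigenvalues i)
      ≤ ∑ i, (hM.isHermitian.eigenvalues i - 1) :=
    Finset.sum_le_sum fun i _ => Real.log_le_sub_one_of_pos (hM.eigenvalues_pos i)
  simpa [Finset.sum_sub_distrib] using this

open scoped MatrixOrder in
/-- Concavity of `log det`. -/
lemma log_det_concave (D B : Mat n) (hD : D.PosDef) (hB : B.PosDef) :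
    Real.log D.det + Real.log B.det ≤ ip D B - n := by
  obtain ⟨C, hC⟩ := CStarAlgebra.nonneg_iff_eq_star_mul_self.mp hD.posSemidef.nonneg
  have hC' : D = Cᴴ * C := hC
  have hdet : D.det = C.det * C.det := by
    rw [hC', Matrix.det_mul, Matrix.det_conjTranspose]; simp
  have hCdet : C.det ≠ 0 := by
    intro h0
    have := hD.det_pos
    rw [hdet, h0] at this; simp at this
  have hCu : IsUnit C := by
    rw [Matrix.isUnit_iff_isUnit_det]; exact isUnit_iff_ne_zero.mpr hCdet
  have hM : (C * B * Cᴴ).PosDef := by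
    have := (Matrix.IsUnit.posDef_star_right_conjugate_iff (x := B) hCu).mpr hB
    exact this
  have h1 := log_det_le_trace _ hM
  have h2 : (C * B * Cᴴ).det = D.det * B.det := by
    rw [hdet, Matrix.det_mul, Matrix.det_mul, Matrix.det_conjTranspose]; simp; ring
  have h3 : (C * B * Cᴴ).trace = ip D B := by
    unfold ip
    rw [hC', Matrix.trace_mul_comm, Matrix.mul_assoc]
    
  rw [h2, h3, Real.log_mul hD.det_pos.ne' hB.det_pos.ne'] at h1
  exact h1

/-- Entrywise power. -/
def hpow (A : Mat n) (m : ℕ) : Mat n := Matrix.of fun i j => A i j ^ m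

lemma hpow_succ (A : Mat n) (m : ℕ) : hpow A (m + 1) = hpow A m ⊙ A := by
  ext i j; simp [hpow, Matrix.hadamard, pow_succ]

lemma hpow_posSemidef (A : Mat n) (hA : A.PosSemidef) (m : ℕ) :
    (hpow A (m + 1)).PosSemidef := by
  induction m with
  | zero =>
    have : hpow A (0 + 1) = A := by ext i j; simp [hpow]
    rw [this]; exact hA
  | succ m ih => rw [hpow_succ]; exact ih.hadamard hA

lemma hpow_mono (A B : Mat n) (hA : A.PosSemidef) (hBA : (B - A).PosSemidef) (m : ℕ) :
    (hpow B (m + 1) - hpow A (m + 1)).PosSemidef := by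
  have hB : B.PosSemidef := by simpa using hA.add hBA
  induction m with
  | zero =>
    have : hpow B (0 + 1) - hpow A (0 + 1) = B - A := by ext i j; simp [hpow]
    rw [this]; exact hBA
  | succ m ih =>
    have : hpow B (m + 1 + 1) - hpow A (m + 1 + 1)
        = (hpow B (m + 1) - hpow A (m + 1)) ⊙ B + hpow A (m + 1) ⊙ (B - A) := by
      ext i j; simp [hpow, Matrix.hadamard, pow_succ]; ring
    rw [this]
    exact (ih.hadamard hB).add ((hpow_posSemidef A hA m).hadamard hBA)

lemma entry_abs_le (A : Mat n) (hA : A.PosSemidef) (hd : ∀ i, A i i ≤ 1) (i j : Fin n) :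
    |A i j| ≤ 1 := by
  have h := (hA.submatrix ![i, j]).det_nonneg
  rw [Matrix.det_fin_two] at h
  simp at h
  have hs : A j i = A i j := by
    have := hA.isHermitian.apply i j
    simpa using this
  rw [hs] at h
  have h1 : 0 ≤ A i i := hA.diag_nonneg
  have h2 : 0 ≤ A j j := hA.diag_nonneg
  have h3 : A i i * A j j ≤ 1 := by nlinarith [hd i, hd j]
  rw [abs_le]; constructor <;> nlinarith

lemma xi'_summable (β : ℕ → Fin n → ℝ)
    (hβsum : ∀ j, Summable fun p : ℕ => (2:ℝ) ^ p * β p j ^ 2) (i j : Fin n) (a : ℝ)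
    (ha : |a| ≤ 1) :
    Summable fun p : ℕ => ((p : ℝ) + 2) * (β (p + 2) i * β (p + 2) j * a ^ (p + 1)) := by
  have hs : Summable fun p : ℕ => (2:ℝ) ^ (p + 2) * β (p + 2) i ^ 2
      + (2:ℝ) ^ (p + 2) * β (p + 2) j ^ 2 :=
    ((summable_nat_add_iff 2).mpr (hβsum i)).add ((summable_nat_add_iff 2).mpr (hβsum j))
  refine Summable.of_norm_bounded hs fun p => ?_
  rw [Real.norm_eq_abs, abs_mul, abs_mul, abs_pow]
  have h1 : |(p : ℝ) + 2| ≤ (2:ℝ) ^ (p + 2) := by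
    rw [abs_of_nonneg (by positivity)]
    have := (Nat.lt_two_pow_self (n := p + 2)).le
    exact_mod_cast this
  have h2 : |a| ^ (p + 1) ≤ 1 := pow_le_one₀ (abs_nonneg _) ha
  have h3 : |β (p + 2) i * β (p + 2) j| ≤ β (p + 2) i ^ 2 + β (p + 2) j ^ 2 := by
    rw [abs_le]; constructor <;> nlinarith [sq_nonneg (β (p + 2) i + β (p + 2) j),
      sq_nonneg (β (p + 2) i - β (p + 2) j), sq_nonneg (β (p + 2) i), sq_nonneg (β (p + 2) j)]
  calc |(p : ℝ) + 2| * (|β (p + 2) i * β (p + 2) j| * |a| ^ (p + 1))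
      ≤ (2:ℝ) ^ (p + 2) * ((β (p + 2) i ^ 2 + β (p + 2) j ^ 2) * 1) := by gcongr
    _ = _ := by ring

lemma xi'_mono (β : ℕ → Fin n → ℝ)
    (hβsum : ∀ j, Summable fun p : ℕ => (2:ℝ) ^ p * β p j ^ 2) (A B : Mat n)
    (hA : A.PosSemidef) (hBA : (B - A).PosSemidef)
    (hAd : ∀ i j, |A i j| ≤ 1) (hBd : ∀ i j, |B i j| ≤ 1) :
    (xi'M β B - xi'M β A).PosSemidef := by
  have hB : B.PosSemidef := by simpa using hA.add hBA
  have hsA : ∀ i j, A j i = A i j := fun i j => by simpa using hA.isHermitian.apply i j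
  have hsB : ∀ i j, B j i = B i j := fun i j => by simpa using hB.isHermitian.apply i j
  refine Matrix.PosSemidef.of_dotProduct_mulVec_nonneg ?_ ?_
  · ext i j
    simp only [xi'M, Matrix.conjTranspose_apply, Matrix.sub_apply, Matrix.of_apply, star_trivial,
      hsA i j, hsB i j, mul_comm (β _ j)]
  · intro v
    have hS : HasSum (fun p : ℕ => ∑ i, ∑ j, v i * ((((p : ℝ) + 2) *
          (β (p + 2) i * β (p + 2) j * B i j ^ (p + 1))
          - ((p : ℝ) + 2) * (β (p + 2) i * β (p + 2) j * A i j ^ (p + 1))) * v j))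
        (∑ i, ∑ j, v i * ((xi'M β B - xi'M β A) i j * v j)) := by
      refine hasSum_sum fun i _ => hasSum_sum fun j _ => ?_
      exact (((xi'_summable β hβsum i j _ (hBd i j)).hasSum.sub
        (xi'_summable β hβsum i j _ (hAd i j)).hasSum).mul_right (v j)).mul_left (v i)
    have : star v ⬝ᵥ (xi'M β B - xi'M β A) *ᵥ v
        = ∑ i, ∑ j, v i * ((xi'M β B - xi'M β A) i j * v j) := by
      simp only [dotProduct, mulVec, star_trivial, Finset.mul_sum]
    rw [this]
    refine hS.nonneg fun p => ?_
    have hq := (hpow_mono A B hA hBA p).dotProduct_mulVec_nonneg (fun i => β (p + 2) i * v i)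
    have he : ∑ i, ∑ j, v i * ((((p : ℝ) + 2) *
          (β (p + 2) i * β (p + 2) j * B i j ^ (p + 1))
          - ((p : ℝ) + 2) * (β (p + 2) i * β (p + 2) j * A i j ^ (p + 1))) * v j)
        = ((p : ℝ) + 2) * (star (fun i => β (p + 2) i * v i) ⬝ᵥ
          (hpow B (p + 1) - hpow A (p + 1)) *ᵥ (fun i => β (p + 2) i * v i)) := by
      simp only [dotProduct, mulVec, star_trivial, Finset.mul_sum]
      refine Finset.sum_congr rfl fun i _ => Finset.sum_congr rfl fun j _ => ?_
      simp [hpow]; ring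
    rw [he]
    exact mul_nonneg (by positivity) hq

lemma abel_ineq (s : ℕ) (x : ℕ → ℝ) (hxpos : ∀ k, 1 ≤ k → k ≤ s → 0 < x k)
    (hxmono : ∀ k, k + 1 ≤ s → x k < x (k + 1)) (D Qs F : ℕ → Mat n) (Q : Mat n)
    (a : ℕ → ℝ) (ha1 : a 1 = 0) (hF1 : F 1 = 0)
    (hD : ∀ k, k + 1 ≤ s → D k = x k • (Qs (k + 1) - Qs k) + D (k + 1))
    (hkey : ∀ k, 1 ≤ k → k ≤ s → ip (D k) (F k) ≤ a k) :
    ∀ m, 1 ≤ m → m ≤ s →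
      (1 / x m) * a m + (ip (F m) Q - ip (F m) (Qs m) - (1 / x m) * ip (D m) (F m))
      ≤ ∑ k ∈ Finset.Ico 1 m, ((1 / x k) * (a (k + 1) - a k)
        + (ip (F (k + 1) - F k) Q - ip (F (k + 1) - F k) (Qs k)
          - (1 / x k) * ip (D k) (F (k + 1) - F k))) := by
  intro m hm
  induction m, hm using Nat.le_induction with
  | base => intro _; simp [ha1, hF1, ip_zero_left, ip_zero_right]
  | succ m hm ih =>
    intro hms
    rw [Finset.sum_Ico_succ_top hm]
    have h1 := ih (by omega)
    have hk := hkey (m + 1) (by omega) hms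
    have hx0 := hxpos m hm (by omega)
    have hx1 := hxmono m hms
    have hinv : 1 / x (m + 1) ≤ 1 / x m := one_div_le_one_div_of_le hx0 hx1.le
    have hDm : ip (D m) (F (m + 1))
        = x m * (ip (F (m + 1)) (Qs (m + 1)) - ip (F (m + 1)) (Qs m))
          + ip (D (m + 1)) (F (m + 1)) := by
      rw [hD m hms, ip_add_left, ip_smul_left, ip_sub_left, ip_comm (Qs (m + 1)),
        ip_comm (Qs m)]
    have hDm' : (1 / x m) * ip (D m) (F (m + 1))
        = (ip (F (m + 1)) (Qs (m + 1)) - ip (F (m + 1)) (Qs m))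
          + (1 / x m) * ip (D (m + 1)) (F (m + 1)) := by
      rw [hDm]; field_simp
    simp only [ip_sub_left, ip_sub_right, mul_sub] at h1 ⊢
    rw [hDm']
    nlinarith [mul_nonneg (sub_nonneg.mpr hinv) (sub_nonneg.mpr hk)]

end Helpers

/-- Removing the error terms from the approximate Parisi functional: at a
critical point it dominates the genuine Parisi functional with the shifted
Lagrange multiplier, whose `Λ̃_1` has positive determinant. -/
theorem approxParisi_ge_Parisi (n : ℕ) (hn : 1 ≤ n) (h : Fin n → ℝ) (β : ℕ → Fin n → ℝ)
    (hβnn : ∀ p j, 0 ≤ β p j)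
    (hβodd : ∀ p : ℕ, Odd p → ∀ j, β p j = 0)
    (hβsum : ∀ j, Summable fun p : ℕ => (2:ℝ) ^ p * β p j ^ 2)
    (Q : Mat n) (hQ : Q.PosDef) (hQdiag : ∀ i, Q i i = 1)
    (r : ℕ) (hr : 2 ≤ r) (ε : ℝ) (hε : 0 < ε)
    (x : ℕ → ℝ) (hx : IsStrictSeq r x)
    (Qs : ℕ → Mat n) (hQs : IsStrictTuple Q r Qs)
    (Λ : Mat n)
    (hΛ : Λ = (Q - Qs (r - 1))⁻¹ + xi'M β Q - xi'M β (Qs (r - 1)) + ε • EC x Qs r (r - 1))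
    (hcrit : ∀ p, 1 ≤ p → p ≤ r - 1 →
      (Dmat x Qs r p)⁻¹ = LE β x Qs Λ r ε p) :
    0 < (Lam β x Qs (Λ + ε • Ebar x (EC x Qs r) r 1) r 1).det ∧
      Pfun β h Q r (Λ + ε • Ebar x (EC x Qs r) r 1) x Qs
        ≤ PfunEpsApprox β h Q r ε Λ x Qs := by
  obtain ⟨s, rfl⟩ : ∃ s, r = s + 1 := ⟨r - 1, by omega⟩
  have hs : 1 ≤ s := by omega
  have hx0 := hx.x0
  have hxmono := hx.xmono
  have hxtop := hx.xtop
  have hQ0 := hQs.Q0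
  have hQr := hQs.Qr
  have hinc := hQs.inc
  simp only [Nat.add_sub_cancel] at hxmono hxtop hcrit
  have hxpos : ∀ k, 1 ≤ k → k ≤ s → 0 < x k := by
    intro k hk
    induction k, hk using Nat.le_induction with
    | base => intro h1; have := hxmono 0 h1; rw [hx0] at this; exact this
    | succ k hk ih => intro h1; exact (ih (by omega)).trans (hxmono k h1)
  have hQpsd : ∀ k, k ≤ s + 1 → (Qs k).PosSemidef := by
    intro k
    induction k with
    | zero => intro _; rw [hQ0]; exact Matrix.PosSemidef.zero
    | succ k ih =>
      intro hk
      have := (ih (by omega)).add (hinc k (by omega)).posSemidef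
      simpa using this
  have hQle : ∀ j k, k + j = s + 1 → (Q - Qs k).PosSemidef := by
    intro j
    induction j with
    | zero =>
      intro k hk
      have : k = s + 1 := by omega
      rw [this, hQr, sub_self]; exact Matrix.PosSemidef.zero
    | succ j ih =>
      intro k hk
      have := (ih (k + 1) (by omega)).add (hinc k (by omega)).posSemidef
      simpa using this
  have hent : ∀ k, k ≤ s + 1 → ∀ i j, |Qs k i j| ≤ 1 := by
    intro k hk
    refine entry_abs_le _ (hQpsd k hk) fun i => ?_
    have := (hQle (s + 1 - k) k (by omega)).diag_nonneg (i := i)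
    rw [Matrix.sub_apply, hQdiag] at this
    linarith
  have htr : Q.trace = n := by simp [Matrix.trace, hQdiag]
  have hlogneg : ∀ k, k ≤ s → Real.log ((Qs (k + 1) - Qs k).det) ≤ 0 := by
    intro k hk
    have h1 := log_det_le_trace _ (hinc k (by omega))
    have h2 := (hQle (s + 1 - (k + 1)) (k + 1) (by omega)).trace_nonneg
    have h3 := (hQpsd k (by omega)).trace_nonneg
    rw [Matrix.trace_sub] at h1 h2
    linarith
  have hbar : barrier Qs (s + 1) ≤ 0 := by
    unfold barrier
    exact Finset.sum_nonpos fun k hk => hlogneg k (by simp at hk; omega)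
  set D : ℕ → Mat n := fun k => Dmat x Qs (s + 1) k with hDdef
  have hDrec : ∀ k, k ≤ s → D k = x k • (Qs (k + 1) - Qs k) + D (k + 1) := by
    intro k hk
    simp only [hDdef, Dmat]
    rw [Finset.sum_eq_sum_Ico_succ_bot (by omega)]
  have hDs : D s = Q - Qs s := by
    rw [hDrec s le_rfl, hxtop, hQr]
    simp [hDdef, Dmat]
  have hDpd : ∀ j k, 1 ≤ k → k + j = s → (D k).PosDef := by
    intro j
    induction j with
    | zero =>
      intro k _ hk
      have : k = s := by omega
      rw [this, hDs, ← hQr]; exact hinc s (by omega)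
    | succ j ih =>
      intro k hk1 hk
      rw [hDrec k (by omega)]
      exact ((hinc k (by omega)).smul (hxpos k hk1 (by omega))).add
        (ih (k + 1) (by omega) (by omega))
  have hDpd' : ∀ k, 1 ≤ k → k ≤ s → (D k).PosDef :=
    fun k h1 h2 => hDpd (s - k) k h1 (by omega)
  set Eb : ℕ → Mat n := fun k => Ebar x (EC x Qs (s + 1)) (s + 1) k with hEbdef
  set L : ℕ → Mat n := fun k => LE β x Qs Λ (s + 1) ε k with hLdef
  set T : ℕ → Mat n := fun k => Lam β x Qs (Λ + ε • Eb 1) (s + 1) k with hTdef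
  have hLinv : ∀ k, 1 ≤ k → k ≤ s → L k = (D k)⁻¹ := fun k h1 h2 => (hcrit k h1 h2).symm
  have hDu : ∀ k, 1 ≤ k → k ≤ s → IsUnit (D k).det := fun k h1 h2 =>
    isUnit_iff_ne_zero.mpr (hDpd' k h1 h2).det_pos.ne'
  have hLinv' : ∀ k, 1 ≤ k → k ≤ s → (L k)⁻¹ = D k := fun k h1 h2 => by
    rw [hLinv k h1 h2, Matrix.nonsing_inv_nonsing_inv _ (hDu k h1 h2)]
  have hLpd : ∀ k, 1 ≤ k → k ≤ s → (L k).PosDef := fun k h1 h2 => by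
    rw [hLinv k h1 h2]; exact (hDpd' k h1 h2).inv
  set F : ℕ → Mat n := fun k => ε • Eb k - ε • Eb 1 with hFdef
  have hLT : ∀ k, T k = L k - F k := by
    intro k
    simp only [hTdef, hLdef, hFdef, LE, Lam]
    simp only [hEbdef]
    abel
  have hF1 : F 1 = 0 := by simp [hFdef]
  have hT1 : T 1 = L 1 := by rw [hLT, hF1, sub_zero]
  have hTrec : ∀ k, k ≤ s → T (k + 1) = T k + x k • (xi'M β (Qs (k + 1)) - xi'M β (Qs k)) := by
    intro k hk
    simp only [hTdef, Lam]
    rw [Finset.sum_eq_sum_Ico_succ_bot (show k < s + 1 by omega)]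
    abel
  have hTpd : ∀ k, 1 ≤ k → k ≤ s + 1 → (T k).PosDef := by
    intro k hk
    induction k, hk using Nat.le_induction with
    | base => intro _; rw [hT1]; exact hLpd 1 le_rfl hs
    | succ k hk ih =>
      intro h1
      rw [hTrec k (by omega)]
      refine (ih (by omega)).add_posSemidef ?_
      refine Matrix.PosSemidef.smul ?_ (hxpos k hk (by omega)).le
      exact xi'_mono β hβsum _ _ (hQpsd k (by omega)) (hinc k (by omega)).posSemidef
        (hent k (by omega)) (hent (k + 1) (by omega))
  have hLr : L (s + 1) = Λ := by
    simp [hLdef, LE, Lam, Ebar]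
  have hTr : T (s + 1) = Λ + ε • Eb 1 := by
    simp [hTdef, Lam]
  set a : ℕ → ℝ := fun k => Real.log (L k).det - Real.log (T k).det with hadef
  have hkey : ∀ k, 1 ≤ k → k ≤ s → ip (D k) (F k) ≤ a k := by
    intro k h1 h2
    have hc := log_det_concave (D k) (T k) (hDpd' k h1 h2) (hTpd k h1 (by omega))
    have hDL : ip (D k) (L k) = n := by
      unfold ip
      rw [hLinv k h1 h2, Matrix.mul_nonsing_inv _ (hDu k h1 h2)]
      simp
    have hld : Real.log (L k).det = - Real.log (D k).det := by
      rw [hLinv k h1 h2, Matrix.det_nonsing_inv, Ring.inverse_eq_inv', Real.log_inv]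
    rw [hLT, ip_sub_right, hDL, ← hLT] at hc
    simp only [hadef]
    linarith
  have hab := abel_ineq s x hxpos hxmono D Qs F Q a (by simp [hadef, hT1]) hF1
    (fun k hk => hDrec k (by omega)) hkey s hs le_rfl
  refine ⟨(hTpd 1 le_rfl (by omega)).det_pos, ?_⟩
  have hlogL : ∀ k, 1 ≤ k → k + 1 ≤ s →
      Real.log ((L (k + 1)).det / (L k).det) = Real.log (L (k + 1)).det - Real.log (L k).det :=
    fun k h1 h2 => Real.log_div (hLpd _ (by omega) h2).det_pos.ne' (hLpd _ h1 (by omega)).det_pos.ne'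
  have hlogT : ∀ k, 1 ≤ k → k ≤ s →
      Real.log ((T (k + 1)).det / (T k).det) = Real.log (T (k + 1)).det - Real.log (T k).det :=
    fun k h1 h2 => Real.log_div (hTpd _ (by omega) (by omega)).det_pos.ne'
      (hTpd _ h1 (by omega)).det_pos.ne'
  have hld : Real.log (L s).det = - Real.log (D s).det := by
    rw [hLinv s hs le_rfl, Matrix.det_nonsing_inv, Ring.inverse_eq_inv', Real.log_inv]
  have htop : - Real.log (L s).det ≤ - Real.log Λ.det + Real.log (Λ.det / (L s).det) := by
    by_cases hΛ0 : Λ.det = 0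
    · have h1 := hlogneg s le_rfl
      rw [hQr, ← hDs] at h1
      rw [hΛ0, hld]
      simpa using h1
    · rw [Real.log_div hΛ0 (hLpd s hs le_rfl).det_pos.ne']
      linarith
  have hDFs : ip (F s) Q - ip (F s) (Qs s) - 1 / x s * ip (D s) (F s) = 0 := by
    rw [hxtop, hDs, ip_sub_left Q (Qs s), ip_comm Q, ip_comm (Qs s)]; ring
  rw [hDFs, hxtop] at hab
  -- the two functionals in reduced form
  have hP : Pfun β h Q (s + 1) (Λ + ε • Eb 1) x Qs
      = (1 / 2) * (ip (vecMulVec h h) (D 1) + ip Λ Q + ε * ip (Eb 1) Q - (n : ℝ)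
        - Real.log (T s).det
        + ∑ k ∈ Finset.Ico 1 s, (1 / x k) * (Real.log (T (k + 1)).det - Real.log (T k).det)
        + ip (xi'M β (Qs 1)) (D 1)
        - ∑ k ∈ Finset.Ico 1 (s + 1), x k * matSum (thetaM β (Qs (k + 1)) - thetaM β (Qs k))) := by
    have hsum : ∑ k ∈ Finset.Ico 1 (s + 1), (1 / x k) * Real.log ((T (k + 1)).det / (T k).det)
        = ∑ k ∈ Finset.Ico 1 s, (1 / x k) * (Real.log (T (k + 1)).det - Real.log (T k).det)
          + (Real.log (Λ + ε • Eb 1).det - Real.log (T s).det) := by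
      rw [Finset.sum_Ico_succ_top hs, hlogT s hs le_rfl, hxtop, hTr]
      congr 1
      · refine Finset.sum_congr rfl fun k hk => ?_
        rw [Finset.mem_Ico] at hk
        rw [hlogT k hk.1 (by omega)]
      · ring
    have hT1' : (Lam β x Qs (Λ + ε • Eb 1) (s + 1) 1)⁻¹ = D 1 := by
      rw [← hLinv' 1 le_rfl hs, ← hT1]
    simp only [hTdef] at hsum
    unfold Pfun
    rw [hsum, hT1', ip_add_left, ip_smul_left]
    ring
  have hPe : (1 / 2) * (ip Λ Q - (n : ℝ) - Real.log (L s).det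
        + ∑ k ∈ Finset.Ico 1 s, (1 / x k) * (Real.log (L (k + 1)).det - Real.log (L k).det)
        + ip (D 1) (vecMulVec h h + xi'M β (Qs 1))
        - ∑ k ∈ Finset.Ico 1 (s + 1), x k * matSum (thetaM β (Qs (k + 1)) - thetaM β (Qs k))
        - ε * ∑ k ∈ Finset.Ico 1 s, ip (Eb (k + 1) - Eb k) (Qs k)
        + ∑ k ∈ Finset.Ico 1 s, (ε / x k) * ip (D k) (Eb k - Eb (k + 1))
        + ε * ip (D s) (Eb s) + ε * ip (Qs s) (Eb s))
      ≤ PfunEpsApprox β h Q (s + 1) ε Λ x Qs := by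
    have hsum : ∑ k ∈ Finset.Ico 1 (s + 1), (1 / x k) * Real.log ((L (k + 1)).det / (L k).det)
        = ∑ k ∈ Finset.Ico 1 s, (1 / x k) * (Real.log (L (k + 1)).det - Real.log (L k).det)
          + Real.log (Λ.det / (L s).det) := by
      rw [Finset.sum_Ico_succ_top hs, hxtop, hLr]
      congr 1
      · refine Finset.sum_congr rfl fun k hk => ?_
        rw [Finset.mem_Ico] at hk
        rw [hlogL k hk.1 (by omega)]
      · ring
    have hsum2 : ∑ k ∈ Finset.Ico 1 s, (ε / x k) * ip (L k)⁻¹ (Eb k - Eb (k + 1))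
        = ∑ k ∈ Finset.Ico 1 s, (ε / x k) * ip (D k) (Eb k - Eb (k + 1)) := by
      refine Finset.sum_congr rfl fun k hk => ?_
      rw [Finset.mem_Ico] at hk
      rw [hLinv' k hk.1 (by omega)]
    have hunf : PfunEpsApprox β h Q (s + 1) ε Λ x Qs
        = (1 / 2) * (ip Λ Q - (n : ℝ) - Real.log Λ.det
          + ∑ k ∈ Finset.Ico 1 (s + 1), (1 / x k) * Real.log ((L (k + 1)).det / (L k).det)
          + ip (L 1)⁻¹ (vecMulVec h h + xi'M β (Qs 1))
          - ∑ k ∈ Finset.Ico 1 (s + 1), x k * matSum (thetaM β (Qs (k + 1)) - thetaM β (Qs k))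
          - ε * ∑ k ∈ Finset.Ico 1 s, ip (Eb (k + 1) - Eb k) (Qs k)
          + ∑ k ∈ Finset.Ico 1 s, (ε / x k) * ip (L k)⁻¹ (Eb k - Eb (k + 1))
          + ε * ip (L s)⁻¹ (Eb s) + ε * ip (Qs s) (Eb s)
          - ε * barrier Qs (s + 1)) := rfl
    rw [hunf, hsum, hsum2, hLinv' 1 le_rfl hs, hLinv' s hs le_rfl]
    have : 0 ≤ -(ε * barrier Qs (s + 1)) := by nlinarith
    linarith
  change Pfun β h Q (s + 1) (Λ + ε • Eb 1) x Qs ≤ _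
  refine le_trans ?_ hPe
  rw [hP]
  -- expand the sum of `hab`
  have htel : ∑ k ∈ Finset.Ico 1 s, ip (F (k + 1) - F k) Q = ε * ip (Eb s) Q - ε * ip (Eb 1) Q := by
    have h1 : ∀ k, ip (F (k + 1) - F k) Q = ε * ip (Eb (k + 1)) Q - ε * ip (Eb k) Q := by
      intro k
      simp only [hFdef, ip_sub_left, ip_smul_left]; ring
    simp only [h1]
    exact Finset.sum_Ico_sub (fun k => ε * ip (Eb k) Q) hs
  have hE : ∑ k ∈ Finset.Ico 1 s, ((1 / x k) * (a (k + 1) - a k)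
        + (ip (F (k + 1) - F k) Q - ip (F (k + 1) - F k) (Qs k)
          - (1 / x k) * ip (D k) (F (k + 1) - F k)))
      = ∑ k ∈ Finset.Ico 1 s, (1 / x k) * (Real.log (L (k + 1)).det - Real.log (L k).det)
        - ∑ k ∈ Finset.Ico 1 s, (1 / x k) * (Real.log (T (k + 1)).det - Real.log (T k).det)
        + ∑ k ∈ Finset.Ico 1 s, ip (F (k + 1) - F k) Q
        - ε * ∑ k ∈ Finset.Ico 1 s, ip (Eb (k + 1) - Eb k) (Qs k)
        + ∑ k ∈ Finset.Ico 1 s, (ε / x k) * ip (D k) (Eb k - Eb (k + 1)) := by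
    rw [Finset.mul_sum, ← Finset.sum_sub_distrib, ← Finset.sum_add_distrib,
      ← Finset.sum_sub_distrib, ← Finset.sum_add_distrib]
    refine Finset.sum_congr rfl fun k _ => ?_
    simp only [hadef, hFdef, ip_sub_left, ip_sub_right, ip_smul_left, ip_smul_right]
    ring
  rw [hE, htel] at hab
  have hDE : ε * ip (D s) (Eb s) + ε * ip (Qs s) (Eb s) = ε * ip (Eb s) Q := by
    rw [hDs, ip_sub_left, ip_comm Q]; ring
  have has : a s = Real.log (L s).det - Real.log (T s).det := rfl
  rw [has] at hab
  rw [ip_add_right, ip_comm (D 1) (vecMulVec h h), ip_comm (D 1) (xi'M β (Qs 1))]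
  linarith


end SphericalSG

end
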